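/- For every fixed real t ∈ (0,∞), the distribution of the range of a uniformly random 1-watermelon (i.e., a single ±1-step bridge of length 2n from (0,0) to (2n,0)) satisfies lim_{n→∞} P{ (R_{n,1}+1)/√n ≤ t } = Σ_{ℓ∈ℤ} (1 − 2(ℓt)²) e^{−(ℓt)²}. -/

import Mathlib

open scoped BigOperators
open Filter

/-- Binomial coefficient with integer lower argument, `0` outside range. -/
def ichoose (a : ℕ) (b : ℤ) : ℕ := if 0 ≤ b then a.choose b.toNat else 0

/-- A `p`-watermelon of length `2n` (no wall): the `i`-th branch starts at `(0,2i)`,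
ends at `(2n,2i)`, takes steps `(1,1)` or `(1,-1)`, and no two branches share a point.
`y i t` is the ordinate of the `i`-th branch at abscissa `t`. -/
def IsMelon (p n : ℕ) (y : Fin p → Fin (2*n+1) → ℤ) : Prop :=
  (∀ i, y i 0 = 2 * (i : ℤ)) ∧
  (∀ i, y i (Fin.last (2*n)) = 2 * (i : ℤ)) ∧
  (∀ i (t : Fin (2*n)), y i t.succ - y i t.castSucc = 1 ∨ y i t.succ - y i t.castSucc = -1) ∧
  (∀ i j, i ≠ j → ∀ t, y i t ≠ y j t)

/-- The height of a watermelon: the maximal ordinate reached (by its top-most branch). -/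
noncomputable def melonHeight {p n : ℕ} (y : Fin p → Fin (2*n+1) → ℤ) : ℤ :=
  sSup {v | ∃ i t, y i t = v}

/-- The depth of a watermelon: the minimal ordinate reached (by its bottom-most branch). -/
noncomputable def melonDepth {p n : ℕ} (y : Fin p → Fin (2*n+1) → ℤ) : ℤ :=
  sInf {v | ∃ i t, y i t = v}

/-- The range of a watermelon: height minus depth. -/
noncomputable def melonRange {p n : ℕ} (y : Fin p → Fin (2*n+1) → ℤ) : ℤ :=
  melonHeight y - melonDepth y


def Wk (a b : ℤ) : (s : ℕ) → ℤ → Finset (Fin (s+1) → ℤ)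
  | 0, x => if x = 0 ∧ a < 0 ∧ 0 < b then {fun _ => 0} else ∅
  | s+1, x => if a < x ∧ x < b then
      (Wk a b s (x-1) ∪ Wk a b s (x+1)).image (fun y => (Fin.snoc y x : Fin (s+1+1) → ℤ)) else ∅

lemma mem_Wk (a b : ℤ) : ∀ (s : ℕ) (x : ℤ) (y : Fin (s+1) → ℤ), y ∈ Wk a b s x ↔
    y 0 = 0 ∧ y (Fin.last s) = x ∧
    (∀ t : Fin s, y t.succ - y t.castSucc = 1 ∨ y t.succ - y t.castSucc = -1) ∧
    (∀ t, a < y t ∧ y t < b) := by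
  intro s
  induction s with
  | zero =>
    intro x y
    unfold Wk
    constructor
    · intro h
      split_ifs at h with h1
      · rw [Finset.mem_singleton] at h
        subst h
        refine ⟨rfl, h1.1.symm, fun t => t.elim0, fun t => h1.2⟩
      · simp at h
    · rintro ⟨h0, h1, -, h3⟩
      have h30 := h3 0
      have : x = 0 := by rw [← h1, ← h0]; rfl
      rw [h0] at h30
      rw [if_pos ⟨this, h30⟩, Finset.mem_singleton]
      funext t
      have : t = 0 := by apply Fin.ext; simp
      rw [this, h0]
  | succ s ih =>
    intro x y
    unfold Wk
    constructor
    · intro h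
      split_ifs at h with h1
      · rw [Finset.mem_image] at h
        obtain ⟨z, hz, rfl⟩ := h
        rw [Finset.mem_union, ih, ih] at hz
        have hz0 : z 0 = 0 := by rcases hz with h | h <;> exact h.1
        have hzl : z (Fin.last s) = x - 1 ∨ z (Fin.last s) = x + 1 := by
          rcases hz with h | h
          · exact Or.inl h.2.1
          · exact Or.inr h.2.1
        have hzs : ∀ t : Fin s, z t.succ - z t.castSucc = 1 ∨ z t.succ - z t.castSucc = -1 := by
          rcases hz with h | h <;> exact h.2.2.1
        have hzb : ∀ t, a < z t ∧ z t < b := by rcases hz with h | h <;> exact h.2.2.2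
        refine ⟨?_, ?_, ?_, ?_⟩
        · have : (0 : Fin (s+1+1)) = (0 : Fin (s+1)).castSucc := rfl
          rw [this, Fin.snoc_castSucc, hz0]
        · exact Fin.snoc_last _ _
        · intro t
          induction t using Fin.lastCases with
          | last =>
            rw [Fin.succ_last, Fin.snoc_last, Fin.snoc_castSucc]
            rcases hzl with h | h <;> rw [h]
            · left; ring
            · right; ring
          | cast t =>
            rw [Fin.succ_castSucc, Fin.snoc_castSucc, Fin.snoc_castSucc]
            exact hzs t
        · intro t
          induction t using Fin.lastCases with
          | last => rw [Fin.snoc_last]; exact h1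
          | cast t => rw [Fin.snoc_castSucc]; exact hzb t
      · simp at h
    · rintro ⟨h0, h1, h2, h3⟩
      have hl := h3 (Fin.last _)
      rw [h1] at hl
      rw [if_pos hl, Finset.mem_image]
      refine ⟨Fin.init y, ?_, ?_⟩
      · have hs := h2 (Fin.last s)
        rw [Fin.succ_last, h1] at hs
        have key : ∀ x', y (Fin.last s).castSucc = x' → Fin.init y ∈ Wk a b s x' := by
          intro x' hx'
          rw [ih]
          refine ⟨h0, hx', fun t => ?_, fun t => h3 _⟩
          exact h2 t.castSucc
        rw [Finset.mem_union]
        rcases hs with h | h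
        · left; apply key; omega
        · right; apply key; omega
      · rw [← h1]; exact Fin.snoc_init_self y

def Cy (M : ℤ) (s : ℕ) (x : ℤ) : ℤ :=
  ∑ j ∈ Finset.range (s+1), (s.choose j : ℤ) * (if 2*M ∣ 2*(j:ℤ) - s - x then 1 else 0)

lemma Cy_succ (M : ℤ) (s : ℕ) (x : ℤ) : Cy M (s+1) x = Cy M s (x-1) + Cy M s (x+1) := by
  unfold Cy
  have := Finset.sum_choose_succ_mul (R := ℤ)
    (fun i _ => if 2*M ∣ 2*(i:ℤ) - (s+1 : ℕ) - x then 1 else 0) s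
  rw [this, add_comm]
  congr 1
  · apply Finset.sum_congr rfl
    intro j _
    have : 2*((j+1 : ℕ):ℤ) - (s+1 : ℕ) - x = 2*(j:ℤ) - s - (x-1) := by push_cast; ring
    rw [this]
  · apply Finset.sum_congr rfl
    intro j _
    have : 2*(j:ℤ) - (s+1 : ℕ) - x = 2*(j:ℤ) - s - (x+1) := by push_cast; ring
    rw [this]

lemma Cy_congr (M : ℤ) (s : ℕ) (x x' : ℤ) (h : 2*M ∣ x - x') : Cy M s x = Cy M s x' := by
  unfold Cy
  apply Finset.sum_congr rfl
  intro j _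
  have : (2*M ∣ 2*(j:ℤ) - s - x) ↔ (2*M ∣ 2*(j:ℤ) - s - x') := by
    have e : 2*(j:ℤ) - s - x' = (2*(j:ℤ) - s - x) + (x - x') := by ring
    rw [e]
    exact (dvd_add_left h).symm
  simp only [this]

lemma card_Wk (a b : ℤ) (ha : a < 0) (hb : 0 < b) : ∀ (s : ℕ) (x : ℤ), a ≤ x → x ≤ b →
    ((Wk a b s x).card : ℤ) = Cy (b - a) s x - Cy (b - a) s (2*b - x) := by
  intro s
  induction s with
  | zero =>
    intro x h1 h2
    have e1 : (2*(b-a) ∣ -x) ↔ x = 0 := by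
      constructor
      · intro h
        rw [dvd_neg] at h
        exact Int.eq_zero_of_abs_lt_dvd h (by rw [abs_lt]; omega)
      · rintro rfl; simp
    have e2 : ¬ (2*(b-a) ∣ x - 2*b) := by
      intro h
      have := Int.eq_zero_of_abs_lt_dvd (x := x - 2*b) h (by rw [abs_lt]; omega)
      omega
    simp only [Wk, Cy, ha, hb]
    by_cases hx : x = 0 
    · subst hx
      have e3 : ¬ (2*(b-a) ∣ 2*b) := by simpa using e2
      simp [e3]
    · simp [e1, e2, hx] 
  | succ s ih =>
    intro x h1 h2
    unfold Wk
    rw [Cy_succ, Cy_succ]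
    split_ifs with h
    · rw [Finset.card_image_of_injective, Finset.card_union_of_disjoint]
      · push_cast
        rw [ih _ (by omega) (by omega), ih _ (by omega) (by omega)]
        have e1 : 2*b - (x-1) = 2*b - x + 1 := by ring
        have e2 : 2*b - (x+1) = 2*b - x - 1 := by ring
        rw [e1, e2]; ring
      · rw [Finset.disjoint_left]
        intro y hy hy'
        rw [mem_Wk] at hy hy'
        have := hy.2.1.symm.trans hy'.2.1
        omega
      · intro y y' hyy
        exact (Fin.snoc_injective2 hyy).1
    · have : x = a ∨ x = b := by omega
      rcases this with rfl | rfl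
      · rw [Cy_congr (b-x) s (2*b - x - 1) (x-1) ⟨1, by ring⟩,
          Cy_congr (b-x) s (2*b - x + 1) (x+1) ⟨1, by ring⟩]
        simp
      · have e1 : 2*x - x - 1 = x - 1 := by ring
        have e2 : 2*x - x + 1 = x + 1 := by ring
        rw [e1, e2]; simp

lemma sum_Cy (M n : ℕ) (hM : 0 < M) :
    ∑ b ∈ Finset.range M, Cy M (2*n) (2*(b:ℤ)) = 4^n := by
  unfold Cy
  rw [Finset.sum_comm]
  have : ∀ j ∈ Finset.range (2*n+1), ∑ b ∈ Finset.range M, ((2*n).choose j : ℤ) *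
      (if 2*(M:ℤ) ∣ 2*(j:ℤ) - (2*n : ℕ) - 2*(b:ℤ) then 1 else 0) = (2*n).choose j := by
    intro j _
    rw [← Finset.mul_sum]
    have hM' : (0:ℤ) < M := by exact_mod_cast hM
    have h0 := Int.emod_nonneg ((j:ℤ) - n) hM'.ne'
    have h1 := Int.emod_lt_of_pos ((j:ℤ) - n) hM'
    rw [Finset.sum_eq_single (((j:ℤ) - n) % M).toNat]
    · rw [if_pos, mul_one]
      rw [Int.toNat_of_nonneg h0]
      have e : 2*(j:ℤ) - (2*n : ℕ) - 2*(((j:ℤ) - n) % M) = 2 * ((j - n) - ((j:ℤ) - n) % M) := by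
        push_cast; ring
      rw [e]
      exact mul_dvd_mul_left 2 (Int.dvd_self_sub_emod)
    · intro b hb hne
      rw [if_neg]
      intro hd
      apply hne
      have e : 2*(j:ℤ) - (2*n : ℕ) - 2*b = 2 * ((j - n) - b) := by
        push_cast; ring
      rw [e] at hd
      have hd' := Int.dvd_of_mul_dvd_mul_left (by norm_num) hd
      have : ((j:ℤ) - n) % M = b % M := Int.emod_eq_emod_iff_emod_sub_eq_zero.2 (Int.emod_eq_zero_of_dvd hd')
      rw [this, Int.emod_eq_of_lt (by omega) (by have := Finset.mem_range.1 hb; omega)]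
      simp
    · intro h
      exfalso; apply h; rw [Finset.mem_range]; omega
  rw [Finset.sum_congr rfl this]
  have h := Nat.sum_range_choose (2*n)
  rw [pow_mul] at h
  exact_mod_cast h

lemma sum_windows (h n : ℕ) :
    ∑ a ∈ Finset.range (h+1), ((Wk (-(a:ℤ)-1) (h-a+1) (2*n) 0).card : ℤ)
      = (h+2) * Cy ((h+2 : ℕ):ℤ) (2*n) 0 - 4^n := by
  rw [← sum_Cy (h+2) n (by omega), Finset.sum_range_succ' _ (h+1)]
  have : ∀ a ∈ Finset.range (h+1), ((Wk (-(a:ℤ)-1) (h-a+1) (2*n) 0).card : ℤ) =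
      Cy ((h+2 : ℕ):ℤ) (2*n) 0 - Cy ((h+2 : ℕ):ℤ) (2*n) (2*(((h+1-1-a)+1:ℕ):ℤ)) := by
    intro a ha
    have ha' := Finset.mem_range.1 ha
    rw [card_Wk _ _ (by omega) (by omega) _ _ (by omega) (by omega)]
    congr 2 <;> push_cast <;> omega
  rw [Finset.sum_congr rfl this, Finset.sum_sub_distrib,
    Finset.sum_range_reflect (fun b => Cy ((h+2 : ℕ):ℤ) (2*n) (2*((b+1:ℕ):ℤ)))]
  simp
  ring

def Br (n : ℕ) : Finset (Fin (2*n+1) → ℤ) := Wk (-(2*n+1)) (2*n+1) (2*n) 0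

lemma walk_bound (s : ℕ) (y : Fin (s+1) → ℤ) (h0 : y 0 = 0)
    (h : ∀ t : Fin s, y t.succ - y t.castSucc = 1 ∨ y t.succ - y t.castSucc = -1) :
    ∀ t : Fin (s+1), |y t| ≤ (t : ℕ) := by
  intro t
  induction t using Fin.induction with
  | zero => simp [h0]
  | succ t ih =>
    have := h t
    rw [abs_le] at *
    simp only [Fin.val_succ, Fin.val_castSucc] at *
    push_cast
    omega

lemma mem_Br (n : ℕ) (y : Fin (2*n+1) → ℤ) : y ∈ Br n ↔ y 0 = 0 ∧ y (Fin.last (2*n)) = 0 ∧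
    (∀ t : Fin (2*n), y t.succ - y t.castSucc = 1 ∨ y t.succ - y t.castSucc = -1) := by
  unfold Br
  rw [mem_Wk]
  constructor
  · rintro ⟨h1, h2, h3, -⟩; exact ⟨h1, h2, h3⟩
  · rintro ⟨h1, h2, h3⟩
    refine ⟨h1, h2, h3, fun t => ?_⟩
    have := walk_bound _ y h1 h3 t
    rw [abs_le] at this
    have := t.2
    omega

lemma isMelon_iff (n : ℕ) (y : Fin 1 → Fin (2*n+1) → ℤ) : IsMelon 1 n y ↔ y 0 ∈ Br n := by
  rw [mem_Br]
  unfold IsMelon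
  constructor
  · rintro ⟨h1, h2, h3, -⟩
    exact ⟨by simpa using h1 0, by simpa using h2 0, h3 0⟩
  · rintro ⟨h1, h2, h3⟩
    refine ⟨fun i => ?_, fun i => ?_, fun i => ?_, fun i j hij => ?_⟩
    · rw [Subsingleton.elim i 0]; simpa using h1
    · rw [Subsingleton.elim i 0]; simpa using h2
    · rw [Subsingleton.elim i 0]; exact h3
    · exact absurd (Subsingleton.elim i j) hij

lemma fin_vals (n : ℕ) (y : Fin 1 → Fin (2*n+1) → ℤ) : {v | ∃ i t, y i t = v}.Finite := by
  have : {v | ∃ i t, y i t = v} = Set.range (fun p : Fin 1 × Fin (2*n+1) => y p.1 p.2) := by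
    ext v; simp
  rw [this]; exact Set.finite_range _

lemma height_le (n : ℕ) (y : Fin 1 → Fin (2*n+1) → ℤ) (u : ℤ) :
    melonHeight y ≤ u ↔ ∀ t, y 0 t ≤ u := by
  unfold melonHeight
  rw [csSup_le_iff (fin_vals n y).bddAbove ⟨y 0 0, 0, 0, rfl⟩]
  constructor
  · intro h t; exact h _ ⟨0, t, rfl⟩
  · rintro h b ⟨i, t, rfl⟩
    rw [Subsingleton.elim i 0]; exact h t

lemma le_depth (n : ℕ) (y : Fin 1 → Fin (2*n+1) → ℤ) (u : ℤ) :
    u ≤ melonDepth y ↔ ∀ t, u ≤ y 0 t := by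
  unfold melonDepth
  rw [le_csInf_iff (fin_vals n y).bddBelow ⟨y 0 0, 0, 0, rfl⟩]
  constructor
  · intro h t; exact h _ ⟨0, t, rfl⟩
  · rintro h b ⟨i, t, rfl⟩
    rw [Subsingleton.elim i 0]; exact h t

lemma Wk_eq (n h a : ℕ) : Wk (-(a:ℤ)-1) (h-a+1) (2*n) 0 =
    (Br n).filter (fun y => -(a:ℤ) ≤ melonDepth (fun _ : Fin 1 => y) ∧
      melonHeight (fun _ : Fin 1 => y) ≤ h - a) := by
  ext y
  rw [Finset.mem_filter, mem_Br, mem_Wk, height_le, le_depth]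
  constructor
  · rintro ⟨h1, h2, h3, h4⟩
    exact ⟨⟨h1, h2, h3⟩, fun t => by have := h4 t; omega, fun t => by have := h4 t; omega⟩
  · rintro ⟨⟨h1, h2, h3⟩, h4, h5⟩
    exact ⟨h1, h2, h3, fun t => by have := h4 t; have := h5 t; omega⟩

lemma window_count (h : ℕ) (d u : ℤ) (hd : d ≤ 0) (hu : 0 ≤ u) :
    ∑ a ∈ Finset.range (h+1), (if -(a:ℤ) ≤ d ∧ u ≤ h - a then 1 else 0 : ℤ) =
      max (h + 1 - (u - d)) 0 := by
  rw [Finset.sum_boole]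
  have : (Finset.range (h+1)).filter (fun a : ℕ => -(a:ℤ) ≤ d ∧ u ≤ h - a) =
      Finset.Ico (-d).toNat (h+1-u).toNat := by
    ext a
    simp only [Finset.mem_filter, Finset.mem_range, Finset.mem_Ico]
    omega
  rw [this, Nat.card_Ico]
  omega

lemma sum_windows' (h n : ℕ) :
    ∑ y ∈ Br n, max ((h:ℤ) + 1 - melonRange (fun _ : Fin 1 => y)) 0
      = (h+2) * Cy ((h+2 : ℕ):ℤ) (2*n) 0 - 4^n := by
  rw [← sum_windows]
  have : ∀ a ∈ Finset.range (h+1), ((Wk (-(a:ℤ)-1) (h-a+1) (2*n) 0).card : ℤ) =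
     ∑ y ∈ Br n, (if -(a:ℤ) ≤ melonDepth (fun _ : Fin 1 => y) ∧
      melonHeight (fun _ : Fin 1 => y) ≤ h - a then 1 else 0) := by
    intro a _
    rw [Wk_eq, Finset.sum_boole]
  rw [Finset.sum_congr rfl this, Finset.sum_comm]
  apply Finset.sum_congr rfl
  intro y hy
  rw [mem_Br] at hy
  rw [window_count]
  · rfl
  · have := (le_depth n (fun _ => y) _).1 le_rfl 0
    simpa [hy.1] using this
  · have := (height_le n (fun _ => y) _).1 le_rfl 0
    simpa [hy.1] using this

lemma Cy_one (n : ℕ) : Cy 1 (2*n) 0 = 4^n := by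
  have := sum_Cy 1 n one_pos
  simpa using this

lemma count_range (m n : ℕ) (hm : 0 < m) :
    (((Br n).filter (fun y => melonRange (fun _ : Fin 1 => y) + 1 ≤ m)).card : ℤ) =
      (m+1) * Cy ((m+1 : ℕ):ℤ) (2*n) 0 - m * Cy (m:ℤ) (2*n) 0 := by
  obtain ⟨h, rfl⟩ : ∃ h, m = h + 1 := ⟨m-1, by omega⟩
  have key : ∑ y ∈ Br n, max ((h:ℤ) - melonRange (fun _ : Fin 1 => y)) 0
      = (h+1) * Cy ((h+1 : ℕ):ℤ) (2*n) 0 - 4^n := by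
    rcases h with _ | h
    · simp only [Nat.cast_zero, zero_add, Nat.cast_one, one_mul, Cy_one, sub_self]
      apply Finset.sum_eq_zero
      intro y hy
      rw [mem_Br] at hy
      have h1 := (le_depth n (fun _ => y) _).1 le_rfl 0
      have h2 := (height_le n (fun _ => y) _).1 le_rfl 0
      unfold melonRange
      omega
    · have := sum_windows' h n
      push_cast at this ⊢
      rw [this]; ring_nf
  have k2 := sum_windows' h n
  have : (((Br n).filter (fun y => melonRange (fun _ : Fin 1 => y) + 1 ≤ (h+1 : ℕ))).card : ℤ) =
    ∑ y ∈ Br n, max ((h:ℤ) + 1 - melonRange (fun _ : Fin 1 => y)) 0 -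
    ∑ y ∈ Br n, max ((h:ℤ) - melonRange (fun _ : Fin 1 => y)) 0 := by
    rw [← Finset.sum_sub_distrib, Finset.card_filter, Nat.cast_sum]
    apply Finset.sum_congr rfl
    intro y _
    split_ifs with hh <;> push_cast at * <;> omega
  rw [this, k2, key]
  push_cast
  ring_nf

lemma card_sub (n : ℕ) (P : (Fin 1 → Fin (2*n+1) → ℤ) → Prop) [DecidablePred P] :
    Nat.card {y : Fin 1 → Fin (2*n+1) → ℤ // IsMelon 1 n y ∧ P y} =
      ((Br n).filter (fun y => P (fun _ => y))).card := by
  rw [← Nat.card_eq_finsetCard]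
  apply Nat.card_congr
  refine ⟨fun y => ⟨y.1 0, ?_⟩, fun z => ⟨fun _ => z.1, ?_⟩, ?_, ?_⟩
  · have h := y.2
    rw [isMelon_iff] at h
    rw [Finset.mem_filter]
    refine ⟨h.1, ?_⟩
    have e : (fun _ => y.1 0) = y.1 := by funext i; rw [Subsingleton.elim i 0]
    rw [e]; exact h.2
  · have h := Finset.mem_filter.1 z.2
    rw [isMelon_iff]
    exact h
  · intro y
    apply Subtype.ext
    funext i; rw [Subsingleton.elim i 0]
  · intro z; rfl

lemma Cy_real (M n : ℕ) (hM : 0 < M) :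
    (Cy (M:ℤ) (2*n) 0 : ℝ) = ∑' l : ℤ, ((2*n).choose (n + l.natAbs * M) : ℝ) := by
  set F : ℤ → ℝ := fun z => if (M:ℤ) ∣ z then ((2*n).choose (n + z.natAbs) : ℝ) else 0 with hF
  have h1 : ∑' l : ℤ, ((2*n).choose (n + l.natAbs * M) : ℝ) = ∑' l : ℤ, F (l * M) := by
    congr 1
    funext l
    simp [hF, Int.natAbs_mul]
  have inj : Function.Injective (fun l : ℤ => l * (M:ℤ)) := by
    intro a b hab
    exact mul_right_cancel₀ (by positivity) hab
  rw [h1, inj.tsum_eq (f := F)]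
  · rw [tsum_eq_sum (s := Finset.image (fun j : ℕ => (j:ℤ) - n) (Finset.range (2*n+1))),
      Finset.sum_image]
    · unfold Cy
      push_cast
      apply Finset.sum_congr rfl
      intro j hj
      have hj' := Finset.mem_range.1 hj
      have e : (2*(M:ℤ) ∣ 2*(j:ℤ) - 2*n - 0) ↔ (M:ℤ) ∣ (j:ℤ) - n := by
        have : 2*(j:ℤ) - 2*n - 0 = 2 * (j - n) := by ring
        rw [this]
        exact mul_dvd_mul_iff_left (by norm_num)
      simp only [hF, e]
      split_ifs
      · rw [mul_one]
        rcases le_total n j with h | h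
        · congr 2; omega
        · rw [← Nat.choose_symm (by omega)]
          congr 2; omega
      · simp
    · intro a _ b _ hab
      simpa using hab
    · intro z hz
      simp only [hF]
      split_ifs
      · rw [Nat.choose_eq_zero_of_lt, Nat.cast_zero]
        by_contra hc
        apply hz
        rw [Finset.mem_image]
        exact ⟨(z+n).toNat, by rw [Finset.mem_range]; omega, by omega⟩
      · rfl
  · intro z hz
    by_contra hc
    apply hz
    simp only [hF]
    rw [if_neg]
    rintro ⟨l, rfl⟩
    exact hc ⟨l, by ring⟩

lemma choose_summable (M n : ℕ) (hM : 0 < M) :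
    Summable (fun l : ℤ => ((2*n).choose (n + l.natAbs * M) : ℝ)) := by
  apply summable_of_ne_finset_zero (s := Finset.Icc (-(n:ℤ)) n)
  intro l hl
  rw [Nat.choose_eq_zero_of_lt, Nat.cast_zero]
  rw [Finset.mem_Icc] at hl
  have : n < l.natAbs := by omega
  nlinarith

lemma Cy_big (M n : ℕ) (hM : n < M) : Cy (M:ℤ) (2*n) 0 = (2*n).choose n := by
  have h := Cy_real M n (by omega)
  rw [tsum_eq_single 0] at h
  · simp only [Int.natAbs_zero, zero_mul, add_zero] at h
    exact_mod_cast h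
  · intro l hl
    rw [Nat.choose_eq_zero_of_lt, Nat.cast_zero]
    have : 1 ≤ l.natAbs := by omega
    nlinarith

lemma card_Br (n : ℕ) : ((Br n).card : ℤ) = (2*n).choose n := by
  have h := count_range (4*n+1) n (by omega)
  rw [Finset.filter_true_of_mem, Cy_big _ _ (by omega), Cy_big _ _ (by omega)] at h
  · rw [h]; push_cast; ring
  · intro y hy
    have hb := mem_Br n y |>.1 hy
    have hw := walk_bound _ y hb.1 hb.2.2
    have h1 := (le_depth n (fun _ => y) (-(2*n))).2 (fun t => by
      have := hw t
      rw [abs_le] at this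
      have := t.2
      show _ ≤ _
      beta_reduce
      omega)
    have h2 := (height_le n (fun _ => y) (2*n)).2 (fun t => by
      have := hw t
      rw [abs_le] at this
      have := t.2
      show _ ≤ _
      beta_reduce
      omega)
    unfold melonRange
    push_cast
    omega

noncomputable def pr (n j : ℕ) : ℝ := ((2*n).choose (n+j) : ℝ) / ((2*n).choose n : ℝ)

lemma pr_nonneg (n j : ℕ) : 0 ≤ pr n j := by unfold pr; positivity

lemma ch_pos (n : ℕ) : (0:ℝ) < ((2*n).choose n : ℝ) := by
  exact_mod_cast Nat.choose_pos (by omega)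

lemma pr_zero (n : ℕ) : pr n 0 = 1 := by
  unfold pr
  exact div_self (ch_pos n).ne'

lemma pr_big (n j : ℕ) (h : n < j) : pr n j = 0 := by
  unfold pr
  rw [Nat.choose_eq_zero_of_lt (by omega)]; simp

lemma pr_succ (n j : ℕ) : pr n (j+1) = pr n j * ((n - j) / (n + j + 1)) := by
  rcases lt_or_ge n j with h | h
  · rw [pr_big n j h, pr_big n (j+1) (by omega)]; simp
  · have e := Nat.choose_succ_right_eq (2*n) (n+j)
    have e2 : 2*n - (n+j) = n - j := by omega
    rw [e2] at e
    have e3 : ((2*n).choose (n+j+1) : ℝ) * (n+j+1) = (2*n).choose (n+j) * (n - j) := by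
      rw [← Nat.cast_sub h]
      exact_mod_cast e
    have hp : (0:ℝ) < n + j + 1 := by positivity
    have := ch_pos n
    unfold pr
    rw [← add_assoc]
    field_simp
    linarith

lemma pr_sub (n j : ℕ) : pr n (j+1) - pr n j = - (pr n j * ((2*j+1) / (n + j + 1))) := by
  rw [pr_succ]
  have hp : (0:ℝ) < n + j + 1 := by positivity
  field_simp
  ring

lemma pr_upper (n : ℕ) (N : ℝ) (hN : 0 < N) : ∀ j : ℕ, (n + j : ℝ) ≤ N →
    pr n j ≤ Real.exp (-((j:ℝ)^2 / N)) := by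
  intro j
  induction j with
  | zero => intro _; simp [pr_zero]
  | succ j ih =>
    intro h
    push_cast at h
    rcases lt_or_ge n j with hj | hj
    · rw [pr_big n (j+1) (by omega)]; positivity
    · rw [pr_succ]
      have hj' : (j:ℝ) ≤ n := by exact_mod_cast hj
      have hp : (0:ℝ) < n + j + 1 := by positivity
      have e : -(((j+1:ℕ):ℝ)^2 / N) = -((j:ℝ)^2 / N) + -((2*j+1)/N) := by
        push_cast; field_simp; ring
      rw [e, Real.exp_add]
      apply mul_le_mul (ih (by linarith)) _ (div_nonneg (by linarith) hp.le) (Real.exp_pos _).le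
      have h1 := Real.add_one_le_exp (-((2*(j:ℝ)+1)/N))
      have h2 : ((n:ℝ) - j) / (n + j + 1) = 1 - (2*j+1)/(n+j+1) := by field_simp; ring
      have h3 : (2*(j:ℝ)+1)/N ≤ (2*j+1)/(n+j+1) := by
        apply div_le_div_of_nonneg_left (by positivity) hp (by linarith)
      linarith

lemma pr_lower (n : ℕ) (N : ℝ) (hN : 0 < N) : ∀ j : ℕ, (N + j : ℝ) ≤ n →
    Real.exp (-((j:ℝ)^2 / N)) ≤ pr n j := by
  intro j
  induction j with
  | zero => intro _; simp [pr_zero]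
  | succ j ih =>
    intro h
    push_cast at h
    rw [pr_succ]
    have hj' : (0:ℝ) < n - j := by linarith
    have hp : (0:ℝ) < n + j + 1 := by positivity
    have e : -(((j+1:ℕ):ℝ)^2 / N) = -((j:ℝ)^2 / N) + -((2*j+1)/N) := by
      push_cast; field_simp; ring
    rw [e, Real.exp_add]
    apply mul_le_mul (ih (by linarith)) _ (Real.exp_pos _).le (pr_nonneg _ _)
    have h1 := Real.add_one_le_exp ((2*(j:ℝ)+1)/N)
    have h2 : ((n:ℝ) - j) / (n + j + 1) = (1 + (2*(j:ℝ)+1)/((n:ℝ)-j))⁻¹ := by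
      have : 1 + (2*(j:ℝ)+1)/((n:ℝ)-j) = (n+j+1)/((n:ℝ)-j) := by field_simp; ring
      rw [this, inv_div]
    have h3 : (2*(j:ℝ)+1)/(n-j) ≤ (2*j+1)/N := by
      apply div_le_div_of_nonneg_left (by positivity) hN (by linarith)
    rw [Real.exp_neg, h2]
    apply inv_anti₀ (by positivity)
    linarith

lemma pr_le (n j : ℕ) (hn : 0 < n) : pr n j ≤ Real.exp (-((j:ℝ)^2 / (2*n))) := by
  have hn' : (0:ℝ) < n := by exact_mod_cast hn
  rcases lt_or_ge n j with hj | hj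
  · rw [pr_big n j hj]; positivity
  · have hj' : (j:ℝ) ≤ n := by exact_mod_cast hj
    exact pr_upper n (2*n) (by positivity) j (by linarith)

lemma sqrt_nat_tendsto : Tendsto (fun n : ℕ => Real.sqrt n) atTop atTop :=
  Real.tendsto_sqrt_atTop.comp tendsto_natCast_atTop_atTop

lemma div_n (j : ℕ → ℕ) (x : ℝ)
    (h : Tendsto (fun n => (j n : ℝ) / Real.sqrt n) atTop (nhds x)) :
    Tendsto (fun n => (j n : ℝ) / n) atTop (nhds 0) := by
  have := h.mul (tendsto_inv_atTop_zero.comp sqrt_nat_tendsto)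
  rw [mul_zero] at this
  refine this.congr (fun n => ?_)
  simp only [Function.comp]
  rw [← div_eq_mul_inv, div_div, Real.mul_self_sqrt (by positivity)]

lemma pr_lim (j : ℕ → ℕ) (x : ℝ)
    (h : Tendsto (fun n => (j n : ℝ) / Real.sqrt n) atTop (nhds x)) :
    Tendsto (fun n => pr n (j n)) atTop (nhds (Real.exp (-x^2))) := by
  have h0 := div_n j x h
  have sq : ∀ n : ℕ, 0 < n → ((j n : ℝ) / Real.sqrt n)^2 = (j n)^2 / n := by
    intro n _
    rw [div_pow, Real.sq_sqrt (by positivity)]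
  have hU : Tendsto (fun n : ℕ => Real.exp (-((j n:ℝ)^2 / (n + j n)))) atTop
      (nhds (Real.exp (-x^2))) := by
    apply (Real.continuous_exp.tendsto _).comp
    apply Tendsto.neg
    have := (h.pow 2).div (h0.const_add 1) (by norm_num)
    rw [add_zero, div_one] at this
    refine this.congr' ?_
    filter_upwards [eventually_gt_atTop 0] with n hn
    simp only [Pi.div_apply]
    have hn' : (0:ℝ) < n := by exact_mod_cast hn
    rw [sq n hn]
    field_simp
  have hL : Tendsto (fun n : ℕ => Real.exp (-((j n:ℝ)^2 / (n - j n)))) atTop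
      (nhds (Real.exp (-x^2))) := by
    apply (Real.continuous_exp.tendsto _).comp
    apply Tendsto.neg
    have := (h.pow 2).div (h0.const_sub 1) (by norm_num)
    rw [sub_zero, div_one] at this
    refine this.congr' ?_
    filter_upwards [eventually_gt_atTop 0, h0.eventually (gt_mem_nhds one_pos)] with n hn hj
    simp only [Pi.div_apply]
    have hn' : (0:ℝ) < n := by exact_mod_cast hn
    rw [div_lt_one hn'] at hj
    have : (0:ℝ) < n - j n := by linarith
    have h2 : (1:ℝ) - j n / n = (n - j n) / n := by field_simp
    rw [sq n hn, h2]
    field_simp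
  refine tendsto_of_tendsto_of_tendsto_of_le_of_le' hL hU ?_ ?_
  · filter_upwards [eventually_gt_atTop 0, h0.eventually (gt_mem_nhds one_pos)] with n hn hj
    have hn' : (0:ℝ) < n := by exact_mod_cast hn
    rw [div_lt_one hn'] at hj
    exact pr_lower n _ (by linarith) _ (by linarith)
  · filter_upwards [eventually_gt_atTop 0] with n hn
    have hn' : (0:ℝ) < n := by exact_mod_cast hn
    exact pr_upper n _ (by positivity) _ le_rfl

lemma pr_diff (n m k : ℕ) : ((m:ℝ)+1) * pr n (k*(m+1)) - m * pr n (k*m) =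
    pr n (k*(m+1)) - ∑ i ∈ Finset.range k,
      pr n (k*m+i) * (m * (2*((k*m+i : ℕ):ℝ)+1) / (n + ((k*m+i : ℕ):ℝ) + 1)) := by
  have h : pr n (k*m+k) - pr n (k*m) = ∑ i ∈ Finset.range k,
      - (pr n (k*m+i) * ((2*((k*m+i : ℕ):ℝ)+1) / (n + ((k*m+i : ℕ):ℝ) + 1))) := by
    have := Finset.sum_range_sub (fun i => pr n (k*m+i)) k
    rw [add_zero] at this
    rw [← this]
    apply Finset.sum_congr rfl
    intro i _
    exact pr_sub n (k*m+i)
  have e : k*(m+1) = k*m+k := by ring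
  rw [e]
  have h2 : (m:ℝ) * (pr n (k*m+k) - pr n (k*m)) = - ∑ i ∈ Finset.range k,
      pr n (k*m+i) * (m * (2*((k*m+i : ℕ):ℝ)+1) / (n + ((k*m+i : ℕ):ℝ) + 1)) := by
    rw [h, Finset.mul_sum, ← Finset.sum_neg_distrib]
    apply Finset.sum_congr rfl
    intro i _
    ring
  linarith

lemma term_lim (m : ℕ → ℕ) (t : ℝ) (k : ℕ)
    (h : Tendsto (fun n => (m n : ℝ) / Real.sqrt n) atTop (nhds t)) :
    Tendsto (fun n => ((m n:ℝ)+1) * pr n (k*(m n+1)) - m n * pr n (k*m n)) atTop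
      (nhds ((1 - 2*((k:ℝ)*t)^2) * Real.exp (-((k:ℝ)*t)^2))) := by
  have hinv : Tendsto (fun n : ℕ => (Real.sqrt n)⁻¹) atTop (nhds 0) :=
    tendsto_inv_atTop_zero.comp sqrt_nat_tendsto
  have hj : ∀ i : ℕ, Tendsto (fun n => ((k * m n + i : ℕ) : ℝ) / Real.sqrt n) atTop
      (nhds (k*t)) := by
    intro i
    have := (h.const_mul (k:ℝ)).add (hinv.const_mul (i:ℝ))
    rw [mul_zero, add_zero] at this
    refine this.congr (fun n => ?_)
    push_cast
    ring
  have hq : ∀ i : ℕ, Tendsto (fun n : ℕ => (m n:ℝ) * (2*((k*m n+i : ℕ):ℝ)+1) /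
      (n + ((k*m n+i : ℕ):ℝ) + 1)) atTop (nhds (t * (2*(k*t)))) := by
    intro i
    have h0 := div_n _ _ (hj i)
    have hi : Tendsto (fun n : ℕ => ((n:ℝ))⁻¹) atTop (nhds 0) := tendsto_inv_atTop_nhds_zero_nat
    have := (h.mul (((hj i).const_mul 2).add hinv)).div ((h0.const_add 1).add hi) (by norm_num)
    simp only [add_zero, div_one] at this
    refine this.congr' ?_
    filter_upwards [eventually_gt_atTop 0] with n hn
    have hn' : (0:ℝ) < n := by exact_mod_cast hn
    have hs : (0:ℝ) < Real.sqrt n := Real.sqrt_pos.2 hn'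
    have hss : Real.sqrt n * Real.sqrt n = n := Real.mul_self_sqrt hn'.le
    simp only [Pi.div_apply]
    generalize ((k * m n + i : ℕ) : ℝ) = J at *
    have e1 : (m n:ℝ) / Real.sqrt n * (2 * (J / Real.sqrt n) + (Real.sqrt n)⁻¹) =
        m n * (2*J+1) / n := by
      nth_rewrite 4 [← hss]
      field_simp
    have e2 : 1 + J / n + (n:ℝ)⁻¹ = (n + J + 1) / n := by field_simp
    rw [e1, e2, div_div_div_cancel_right₀ hn'.ne']
  have hA : Tendsto (fun n => pr n (k*(m n+1))) atTop (nhds (Real.exp (-((k:ℝ)*t)^2))) := by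
    have := pr_lim _ _ (hj k)
    exact this
  have hS : Tendsto (fun n => ∑ i ∈ Finset.range k,
      pr n (k*m n+i) * (m n * (2*((k*m n+i : ℕ):ℝ)+1) / (n + ((k*m n+i : ℕ):ℝ) + 1))) atTop
      (nhds (∑ i ∈ Finset.range k, Real.exp (-((k:ℝ)*t)^2) * (t * (2*(k*t))))) :=
    tendsto_finsetSum _ (fun i _ => (pr_lim _ _ (hj i)).mul (hq i))
  have := hA.sub hS
  rw [Finset.sum_const, Finset.card_range, nsmul_eq_mul] at this
  have e : (1 - 2*((k:ℝ)*t)^2) * Real.exp (-((k:ℝ)*t)^2) = Real.exp (-((k:ℝ)*t)^2) -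
    k * (Real.exp (-((k:ℝ)*t)^2) * (t * (2*(k*t)))) := by ring
  rw [e]
  exact this.congr (fun n => (pr_diff n (m n) k).symm)

lemma term_bound (n m k : ℕ) (t : ℝ) (ht : 0 < t) (hn : 0 < n) (hm : 0 < m)
    (h1 : t^2/4 * n ≤ (m:ℝ)^2) (h2 : (m:ℝ)^2 ≤ t^2 * n) :
    |((m:ℝ)+1) * pr n (k*(m+1)) - m * pr n (k*m)| ≤
      (1 + 4 * t^2 * (k:ℝ)^2) * Real.exp (-(t^2/8) * k) := by
  have hn' : (0:ℝ) < n := by exact_mod_cast hn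
  have hm' : (1:ℝ) ≤ m := by exact_mod_cast hm
  have hp : ∀ j, k*m ≤ j → pr n j ≤ Real.exp (-(t^2/8) * k) := by
    intro j hj
    refine (pr_le n j hn).trans (Real.exp_le_exp.2 ?_)
    have hj' : (k:ℝ)*m ≤ j := by exact_mod_cast hj
    have a1 : ((k:ℝ)*m)^2 ≤ (j:ℝ)^2 := by gcongr
    have a2 : (k:ℝ) ≤ (k:ℝ)^2 := by exact_mod_cast Nat.le_self_pow (by norm_num) k
    rw [neg_mul, neg_le_neg_iff, le_div_iff₀ (by positivity)]
    calc t^2/8 * k * (2*n) = (k:ℝ) * (t^2/4*n) := by ring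
      _ ≤ (k:ℝ)^2 * (m:ℝ)^2 := by gcongr
      _ = ((k:ℝ)*m)^2 := by ring
      _ ≤ _ := a1
  rw [pr_diff]
  set E := Real.exp (-(t^2/8) * k)
  have hE : 0 ≤ E := (Real.exp_pos _).le
  have b1 : |pr n (k*(m+1))| ≤ E := by
    rw [abs_of_nonneg (pr_nonneg _ _)]
    exact hp _ (by nlinarith)
  have b2 : |∑ i ∈ Finset.range k,
      pr n (k*m+i) * (m * (2*((k*m+i : ℕ):ℝ)+1) / (n + ((k*m+i : ℕ):ℝ) + 1))| ≤
      ∑ i ∈ Finset.range k, E * (4*t^2*k) := by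
    refine (Finset.abs_sum_le_sum_abs _ _).trans (Finset.sum_le_sum ?_)
    intro i hi
    have hi' : (i:ℝ) + 1 ≤ k := by exact_mod_cast Finset.mem_range.1 hi
    have := pr_nonneg n (k*m+i)
    rw [abs_of_nonneg (by positivity)]
    apply mul_le_mul (hp _ (by omega)) _ (by positivity) hE
    rw [div_le_iff₀ (by positivity)]
    push_cast
    have hk : (0:ℝ) ≤ k := by positivity
    calc (m:ℝ) * (2*(k*m+i)+1) ≤ m * (2*(k*m+k*m)) := by
          gcongr (m:ℝ) * ?_
          nlinarith
      _ = 4 * k * (m:ℝ)^2 := by ring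
      _ ≤ 4 * k * (t^2*n) := by gcongr
      _ = 4*t^2*k * n := by ring
      _ ≤ _ := by
        gcongr
        have : (0:ℝ) ≤ k*m+i := by positivity
        linarith
  rw [Finset.sum_const, Finset.card_range, nsmul_eq_mul] at b2
  refine (abs_sub _ _).trans ?_
  calc _ ≤ E + k * (E * (4*t^2*k)) := add_le_add b1 b2
    _ = _ := by ring

lemma bound_summable (t : ℝ) (ht : 0 < t) :
    Summable (fun l : ℤ => (1 + 4 * t^2 * (l.natAbs:ℝ)^2) * Real.exp (-(t^2/8) * l.natAbs)) := by
  have h : Summable (fun k : ℕ => (1 + 4 * t^2 * (k:ℝ)^2) * Real.exp (-(t^2/8) * k)) := by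
    have h0 := Real.summable_pow_mul_exp_neg_nat_mul 0 (r := t^2/8) (by positivity)
    have h2 := Real.summable_pow_mul_exp_neg_nat_mul 2 (r := t^2/8) (by positivity)
    refine (h0.add (h2.mul_left (4*t^2))).congr (fun k => ?_)
    ring
  apply Summable.of_nat_of_neg
  · simpa using h
  · simpa using h

open Classical in
lemma prob_eq (n m : ℕ) (t : ℝ) (hn : 0 < n) (hm : 0 < m) (hmt : m = ⌊t * Real.sqrt n⌋₊) :
    (Nat.card {y : Fin 1 → Fin (2*n+1) → ℤ //
            IsMelon 1 n y ∧ ((melonRange y : ℝ) + 1)/Real.sqrt n ≤ t} : ℝ) /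
          (Nat.card {y : Fin 1 → Fin (2*n+1) → ℤ // IsMelon 1 n y} : ℝ) =
    ∑' l : ℤ, (((m:ℝ)+1) * pr n (l.natAbs*(m+1)) - m * pr n (l.natAbs*m)) := by
  have hs : (0:ℝ) < Real.sqrt n := Real.sqrt_pos.2 (by exact_mod_cast hn)
  have hd : (Nat.card {y : Fin 1 → Fin (2*n+1) → ℤ // IsMelon 1 n y} : ℝ) = (2*n).choose n := by
    have := card_sub n (fun _ => True)
    simp only [and_true, Finset.filter_true] at this
    rw [this]
    exact_mod_cast card_Br n
  have hc : (Nat.card {y : Fin 1 → Fin (2*n+1) → ℤ //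
            IsMelon 1 n y ∧ ((melonRange y : ℝ) + 1)/Real.sqrt n ≤ t} : ℝ) =
      (m+1) * (Cy ((m+1 : ℕ):ℤ) (2*n) 0 : ℝ) - m * (Cy (m:ℤ) (2*n) 0 : ℝ) := by
    rw [card_sub n (fun y => ((melonRange y : ℝ) + 1)/Real.sqrt n ≤ t)]
    have := count_range m n hm
    rw [← Int.cast_natCast (R := ℝ)]
    have e : (Br n).filter (fun y => ((melonRange (fun _ : Fin 1 => y) : ℝ) + 1)/Real.sqrt n ≤ t)
        = (Br n).filter (fun y => melonRange (fun _ : Fin 1 => y) + 1 ≤ m) := by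
      apply Finset.filter_congr
      intro y _
      have hpos : 0 ≤ t * Real.sqrt n := by
        by_contra hneg
        rw [Nat.floor_of_nonpos (by linarith)] at hmt
        omega
      rw [div_le_iff₀ hs, hmt, Int.natCast_floor_eq_floor hpos, Int.le_floor]
      push_cast
      rfl
    rw [e, this]
    push_cast
    rfl
  rw [hd, hc, Cy_real _ _ (by omega), Cy_real _ _ hm, ← tsum_mul_left, ← tsum_mul_left,
    ← Summable.tsum_sub ((choose_summable _ _ (by omega)).mul_left _)
      ((choose_summable _ _ hm).mul_left _), ← tsum_div_const]
  congr 1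
  funext l
  unfold pr
  ring

/-- Weak limit of the range of a random `1`-watermelon (a `±1`-step bridge of length `2n`):
`P{(R_{n,1}+1)/√n ≤ t} → Σ_{ℓ∈ℤ} (1 − 2(ℓt)²) e^{-(ℓt)²}`. -/
theorem stmt18 (t : ℝ) (ht : 0 < t) :
    Filter.Tendsto
      (fun n : ℕ =>
        (Nat.card {y : Fin 1 → Fin (2*n+1) → ℤ //
            IsMelon 1 n y ∧ ((melonRange y : ℝ) + 1)/Real.sqrt n ≤ t} : ℝ) /
          (Nat.card {y : Fin 1 → Fin (2*n+1) → ℤ // IsMelon 1 n y} : ℝ))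
      atTop
      (nhds (∑' ℓ : ℤ, (1 - 2*((ℓ : ℝ)*t)^2) * Real.exp (-((ℓ : ℝ)*t)^2))) := by
  set m : ℕ → ℕ := fun n => ⌊t * Real.sqrt n⌋₊ with hm
  have hlim : Tendsto (fun n => (m n : ℝ) / Real.sqrt n) atTop (nhds t) :=
    (tendsto_nat_floor_mul_div_atTop (R := ℝ) ht.le).comp sqrt_nat_tendsto
  have hev : ∀ᶠ n : ℕ in atTop, 0 < n ∧ 0 < m n ∧ t^2/4 * n ≤ (m n:ℝ)^2 ∧
      (m n:ℝ)^2 ≤ t^2 * n := by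
    filter_upwards [eventually_gt_atTop 0, hlim.eventually (lt_mem_nhds (half_lt_self ht))]
      with n hn hl
    have hn' : (0:ℝ) < n := by exact_mod_cast hn
    have hs : (0:ℝ) < Real.sqrt n := Real.sqrt_pos.2 hn'
    have hss : Real.sqrt n ^2 = n := Real.sq_sqrt hn'.le
    rw [lt_div_iff₀ hs] at hl
    have hle : (m n:ℝ) ≤ t * Real.sqrt n := Nat.floor_le (by positivity)
    have hpos : (0:ℝ) < t / 2 * Real.sqrt n := by positivity
    refine ⟨hn, ?_, ?_, ?_⟩
    · have : (0:ℝ) < m n := hpos.trans hl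
      exact_mod_cast this
    · calc t^2/4 * n = (t / 2 * Real.sqrt n)^2 := by rw [mul_pow, hss]; ring
        _ ≤ _ := by gcongr
    · calc (m n:ℝ)^2 ≤ (t * Real.sqrt n)^2 := by gcongr
        _ = _ := by rw [mul_pow, hss]
  have main : Tendsto (fun n => ∑' l : ℤ, (((m n:ℝ)+1) * pr n (l.natAbs*(m n+1)) -
      m n * pr n (l.natAbs*m n))) atTop
      (nhds (∑' ℓ : ℤ, (1 - 2*((ℓ : ℝ)*t)^2) * Real.exp (-((ℓ : ℝ)*t)^2))) := by
    apply tendsto_tsum_of_dominated_convergence (bound_summable t ht)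
    · intro l
      have := term_lim m t l.natAbs hlim
      have e : ((l:ℝ)*t)^2 = ((l.natAbs:ℝ)*t)^2 := by
        rw [mul_pow, mul_pow, Nat.cast_natAbs, Int.cast_abs, sq_abs]
      rw [e]
      exact this
    · filter_upwards [hev] with n hn l
      rw [Real.norm_eq_abs]
      exact term_bound n (m n) l.natAbs t ht hn.1 hn.2.1 hn.2.2.1 hn.2.2.2
  refine main.congr' ?_
  filter_upwards [hev] with n hn
  exact (prob_eq n (m n) t hn.1 hn.2.1 rfl).symm
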